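/- arXiv:2110.04706 — 5 statements merged into one kernel-verified Lean document; each statement's English description precedes it below -/
import Mathlib

section
/- Let E be a finite-dimensional real inner product space and let L : E → E and A : E → E be self-adjoint linear operators. Let λ_1 ≤ λ_2 ≤ … ≤ λ_n denote the eigenvalues of L and λ'_1 ≤ λ'_2 ≤ … ≤ λ'_n the eigenvalues of L + A, both listed in nondecreasing order with multiplicity. Then for every index i, |λ'_i − λ_i| ≤ ‖A‖, where ‖A‖ is the operator norm of A. -/
open scoped RealInnerProductSpace

section

variable {E ι : Type*} [NormedAddCommGroup E] [InnerProductSpace ℝ E]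

theorem OrthonormalBasis.inner_map_self_eq_sum_of_eigenvectors [Fintype ι]
    (b : OrthonormalBasis ι ℝ E) {T : E →L[ℝ] E} {μ : ι → ℝ}
    (hb : ∀ i, T (b i) = μ i • b i) (x : E) :
    ⟪T x, x⟫ = ∑ i, μ i * ⟪b i, x⟫ ^ 2 := by
  have hx : T x = ∑ i, ⟪b i, x⟫ • μ i • b i := by
    conv_lhs => rw [← b.sum_repr' x]
    simp [map_sum, hb]
  rw [hx, sum_inner]
  refine Finset.sum_congr rfl fun i _ => ?_
  rw [real_inner_smul_left, real_inner_smul_left]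
  ring

theorem exists_ne_zero_forall_ne_inner_eq_zero [FiniteDimensional ℝ E] [Fintype ι]
    (hι : Module.finrank ℝ E = Fintype.card ι) (v : ι → E) (i : ι) :
    ∃ x : E, x ≠ 0 ∧ ∀ j, j ≠ i → ⟪v j, x⟫ = 0 := by
  classical
  let f : E →ₗ[ℝ] ({j // j ≠ i} → ℝ) := LinearMap.pi fun j => innerₗ E (v j)
  have hf : f.ker ≠ ⊥ := by
    apply LinearMap.ker_ne_bot_of_finrank_lt
    rw [Module.finrank_fintype_fun_eq_card, hι]
    exact Fintype.card_subtype_lt (x := i) (by simp)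
  obtain ⟨x, hx, hx0⟩ := Submodule.exists_mem_ne_zero_of_ne_bot hf
  exact ⟨x, hx0, fun j hj => congrFun (LinearMap.mem_ker.mp hx) ⟨j, hj⟩⟩

theorem OrthonormalBasis.eigenvalue_le_add_norm_sub [FiniteDimensional ℝ E]
    [Fintype ι] [LinearOrder ι] {S T : E →L[ℝ] E} {μ ν : ι → ℝ}
    (hμ : Monotone μ) (hν : Monotone ν) (b c : OrthonormalBasis ι ℝ E)
    (hb : ∀ i, S (b i) = μ i • b i) (hc : ∀ i, T (c i) = ν i • c i) (i : ι) :
    ν i ≤ μ i + ‖T - S‖ := by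
  obtain ⟨x, hx0, hx⟩ := exists_ne_zero_forall_ne_inner_eq_zero
    (Module.finrank_eq_card_basis b.toBasis) (fun j => if j < i then c j else b j) i
  have hS : ⟪S x, x⟫ ≤ μ i * ‖x‖ ^ 2 := by
    rw [b.inner_map_self_eq_sum_of_eigenvectors hb, ← b.sum_sq_inner_right x, Finset.mul_sum]
    refine Finset.sum_le_sum fun j _ => ?_
    rcases le_or_gt j i with hj | hj
    · exact mul_le_mul_of_nonneg_right (hμ hj) (sq_nonneg _)
    · have := hx j hj.ne'
      simp only [if_neg hj.not_gt] at this
      simp [this]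
  have hT : ν i * ‖x‖ ^ 2 ≤ ⟪T x, x⟫ := by
    rw [c.inner_map_self_eq_sum_of_eigenvectors hc, ← c.sum_sq_inner_right x, Finset.mul_sum]
    refine Finset.sum_le_sum fun j _ => ?_
    rcases lt_or_ge j i with hj | hj
    · have := hx j hj.ne
      simp only [if_pos hj] at this
      simp [this]
    · exact mul_le_mul_of_nonneg_right (hν hj) (sq_nonneg _)
  have hTS : ⟪T x, x⟫ - ⟪S x, x⟫ ≤ ‖T - S‖ * ‖x‖ ^ 2 := by
    calc ⟪T x, x⟫ - ⟪S x, x⟫ = ⟪(T - S) x, x⟫ := by simp [inner_sub_left]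
      _ ≤ ‖(T - S) x‖ * ‖x‖ := real_inner_le_norm _ _
      _ ≤ ‖T - S‖ * ‖x‖ * ‖x‖ := by gcongr; exact (T - S).le_opNorm x
      _ = ‖T - S‖ * ‖x‖ ^ 2 := by ring
  have hpos : 0 < ‖x‖ ^ 2 := by positivity
  refine le_of_mul_le_mul_right ?_ hpos
  linarith

end

/-- **Weyl's eigenvalue perturbation inequality.** If `L` and `A` are self-adjoint
operators on a finite-dimensional real inner product space, with eigenvalues of `L`
listed in nondecreasing order (with multiplicity) as `μ` and those of `L + A` as `μ'`,
then `|μ' i - μ i| ≤ ‖A‖` for every index `i`. -/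
theorem weyl_eigenvalue_perturbation
    {E : Type*} [NormedAddCommGroup E] [InnerProductSpace ℝ E] [FiniteDimensional ℝ E]
    {n : ℕ} (L A : E →L[ℝ] E)
    (hL : ∀ x y : E, ⟪L x, y⟫ = ⟪x, L y⟫)
    (hA : ∀ x y : E, ⟪A x, y⟫ = ⟪x, A y⟫)
    (μ μ' : Fin n → ℝ) (hμ : Monotone μ) (hμ' : Monotone μ')
    (b b' : OrthonormalBasis (Fin n) ℝ E)
    (hb : ∀ i, L (b i) = μ i • b i)
    (hb' : ∀ i, (L + A) (b' i) = μ' i • b' i) :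
    ∀ i, |μ' i - μ i| ≤ ‖A‖ := by
  intro i
  have h₁ := OrthonormalBasis.eigenvalue_le_add_norm_sub hμ hμ' b b' hb hb' i
  have h₂ := OrthonormalBasis.eigenvalue_le_add_norm_sub hμ' hμ b' b hb' hb i
  rw [add_sub_cancel_left] at h₁
  rw [norm_sub_rev, add_sub_cancel_left] at h₂
  rw [abs_le]
  constructor <;> linarith
end

section
/- Let E be a finite-dimensional real inner product space and let L : E → E and A : E → E be self-adjoint linear operators. Let λ_1 ≤ … ≤ λ_n be the eigenvalues of L, λ'_1 ≤ … ≤ λ'_n the eigenvalues of L + A, and λ_max(A) the largest eigenvalue of A, all with multiplicity. Then for every index i, λ'_i ≤ λ_i + λ_max(A). -/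
open scoped RealInnerProductSpace

theorem OrthonormalBasis.real_inner_apply_self_eq_sum {ι E : Type*} [Fintype ι]
    [NormedAddCommGroup E] [InnerProductSpace ℝ E] (b : OrthonormalBasis ι ℝ E)
    (T : E →L[ℝ] E) {μ : ι → ℝ} (hb : ∀ i, T (b i) = μ i • b i) (x : E) :
    ⟪T x, x⟫ = ∑ i, μ i * ⟪b i, x⟫ ^ 2 := by
  conv_lhs => enter [2]; rw [← b.sum_repr' x, map_sum]
  rw [sum_inner]
  refine Finset.sum_congr rfl fun i _ => ?_
  rw [map_smul, hb, real_inner_smul_left, real_inner_smul_left]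
  ring

theorem OrthonormalBasis.real_inner_apply_self_le {ι E : Type*} [Fintype ι]
    [NormedAddCommGroup E] [InnerProductSpace ℝ E] (b : OrthonormalBasis ι ℝ E)
    (T : E →L[ℝ] E) {μ : ι → ℝ} (hb : ∀ i, T (b i) = μ i • b i) {x : E} {a : ℝ}
    (h : ∀ i, ⟪b i, x⟫ = 0 ∨ μ i ≤ a) : ⟪T x, x⟫ ≤ a * ‖x‖ ^ 2 := by
  rw [b.real_inner_apply_self_eq_sum T hb, ← b.sum_sq_inner_right x, Finset.mul_sum]
  refine Finset.sum_le_sum fun i _ => ?_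
  rcases h i with h | h
  · simp [h]
  · gcongr

theorem OrthonormalBasis.le_real_inner_apply_self {ι E : Type*} [Fintype ι]
    [NormedAddCommGroup E] [InnerProductSpace ℝ E] (b : OrthonormalBasis ι ℝ E)
    (T : E →L[ℝ] E) {μ : ι → ℝ} (hb : ∀ i, T (b i) = μ i • b i) {x : E} {a : ℝ}
    (h : ∀ i, ⟪b i, x⟫ = 0 ∨ a ≤ μ i) : a * ‖x‖ ^ 2 ≤ ⟪T x, x⟫ := by
  rw [b.real_inner_apply_self_eq_sum T hb, ← b.sum_sq_inner_right x, Finset.mul_sum]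
  refine Finset.sum_le_sum fun i _ => ?_
  rcases h i with h | h
  · simp [h]
  · gcongr

/-- There is a nonzero vector orthogonal to any family of fewer than `n` vectors in a space
of dimension `n`. -/
theorem exists_ne_zero_forall_real_inner_eq_zero {κ E : Type*} [Fintype κ]
    [NormedAddCommGroup E] [InnerProductSpace ℝ E] [FiniteDimensional ℝ E] (v : κ → E)
    (h : Fintype.card κ < Module.finrank ℝ E) : ∃ x : E, x ≠ 0 ∧ ∀ k, ⟪v k, x⟫ = 0 := by
  have hker : (LinearMap.pi fun k => innerₛₗ ℝ (v k)).ker ≠ ⊥ :=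
    LinearMap.ker_ne_bot_of_finrank_lt (by simpa using h)
  obtain ⟨x, hx, hx0⟩ := Submodule.exists_mem_ne_zero_of_ne_bot hker
  exact ⟨x, hx0, fun k => congrFun (LinearMap.mem_ker.mp hx) k⟩

/-- If `L` and `A` are self-adjoint operators on a finite-dimensional real inner
product space, with eigenvalues (in nondecreasing order with multiplicity) `μ` of `L`,
`μ'` of `L + A`, and `ν` of `A`, then `μ' i ≤ μ i + λ_max(A)` for every `i`, where
`λ_max(A) = ν (n-1)` is the largest eigenvalue of `A`. -/
theorem eigenvalue_upper_bound_perturbation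
    {E : Type*} [NormedAddCommGroup E] [InnerProductSpace ℝ E] [FiniteDimensional ℝ E]
    {n : ℕ} (L A : E →L[ℝ] E)
    (hL : ∀ x y : E, ⟪L x, y⟫ = ⟪x, L y⟫)
    (hA : ∀ x y : E, ⟪A x, y⟫ = ⟪x, A y⟫)
    (μ μ' ν : Fin n → ℝ) (hμ : Monotone μ) (hμ' : Monotone μ') (hν : Monotone ν)
    (b b' c : OrthonormalBasis (Fin n) ℝ E)
    (hb : ∀ i, L (b i) = μ i • b i)
    (hb' : ∀ i, (L + A) (b' i) = μ' i • b' i)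
    (hc : ∀ i, A (c i) = ν i • c i) :
    ∀ i : Fin n, μ' i ≤ μ i + ν ⟨n - 1, Nat.sub_lt i.pos one_pos⟩ := by
  intro i
  have hcard : Fintype.card {j : Fin n // j ≠ i} < Module.finrank ℝ E := by
    rw [Module.finrank_eq_card_basis b.toBasis]
    exact Fintype.card_subtype_lt (x := i) (by simp)
  obtain ⟨x, hx0, hx⟩ := exists_ne_zero_forall_real_inner_eq_zero
    (fun j : {j : Fin n // j ≠ i} => if i < j.1 then b j else b' j) hcard
  have hLx : ⟪L x, x⟫ ≤ μ i * ‖x‖ ^ 2 := b.real_inner_apply_self_le L hb fun j => by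
    rcases lt_or_ge i j with hj | hj
    · exact Or.inl (by simpa [hj] using hx ⟨j, hj.ne'⟩)
    · exact Or.inr (hμ hj)
  have hAx : ⟪A x, x⟫ ≤ ν ⟨n - 1, Nat.sub_lt i.pos one_pos⟩ * ‖x‖ ^ 2 :=
    c.real_inner_apply_self_le A hc fun j => Or.inr (hν (Fin.le_def.mpr (Nat.le_pred_of_lt j.2)))
  have hLAx : μ' i * ‖x‖ ^ 2 ≤ ⟪(L + A) x, x⟫ := b'.le_real_inner_apply_self (L + A) hb' fun j => by
    rcases lt_or_ge j i with hj | hj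
    · exact Or.inl (by simpa [hj.not_gt] using hx ⟨j, hj.ne⟩)
    · exact Or.inr (hμ' hj)
  rw [add_apply, inner_add_left] at hLAx
  refine le_of_mul_le_mul_right ?_ (pow_pos (norm_pos_iff.mpr hx0) 2)
  rw [add_mul]
  exact hLAx.trans (add_le_add hLx hAx)
end

section
/- Let E be a finite-dimensional real inner product space and L : E → E self-adjoint, and suppose the set of eigenvalues of L admits an α-separated partition Λ_1 ∪ … ∪ Λ_N for some α > 0, meaning that any two eigenvalues lying in different parts differ by more than α. Let A : E → E be self-adjoint with ‖A‖ = ε and 0 < ε < α, and set L' = L + A. List the eigenvalues λ_1 ≤ … ≤ λ_n of L and λ'_1 ≤ … ≤ λ'_n of L' in nondecreasing order with multiplicity, and associate λ'_i with the part Λ_k containing λ_i. Let h : ℝ → ℝ be B-Lipschitz with |h(λ)| ≤ 1 for all λ ∈ ℝ, and suppose that |h(x) − h(y)| ≤ π ε / (2(α − ε)) whenever x and y are eigenvalues of L or of L' associated with the same part Λ_k. Then for every f ∈ E, ‖h(L)f − h(L')f‖ ≤ (N π / (α − ε) + B) · ε · ‖f‖. -/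
open scoped RealInnerProductSpace

section Kernel
open MeasureTheory Set Filter Topology

/-- One-sided exponential kernel. -/
noncomputable def expKernel (t : ℝ) : ℝ := if 0 ≤ t then 2 * Real.exp (-t) else 0

/-- Square-integrable kernel whose convolution with `expKernel` agrees with `1 / t` for `1 ≤ |t|`. -/
noncomputable def invKernel (t : ℝ) : ℝ :=
  if |t| ≤ 1 then (t + 1) / 2 else (1 / t - 1 / t ^ 2) / 2

lemma measurable_expKernel : Measurable expKernel := by
  unfold expKernel
  exact Measurable.ite measurableSet_Ici (by fun_prop) measurable_const

lemma measurable_invKernel : Measurable invKernel := by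
  unfold invKernel
  refine Measurable.ite (measurableSet_le (by fun_prop) measurable_const) (by fun_prop) (by fun_prop)

lemma invKernel_of_abs_gt {t : ℝ} (ht : 1 < |t|) : invKernel t = (1 / t - 1 / t ^ 2) / 2 := by
  simp [invKernel, not_le.2 ht]

lemma invKernel_of_abs_le {t : ℝ} (ht : |t| ≤ 1) : invKernel t = (t + 1) / 2 := by
  simp [invKernel, ht]

lemma expKernel_sq_hasIntegral :
    Integrable (fun t => expKernel t ^ 2) ∧ ∫ t, expKernel t ^ 2 = 2 := by
  have hfun : (fun t => expKernel t ^ 2) =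
      (Ici (0 : ℝ)).indicator (fun t => 4 * Real.exp (-2 * t)) := by
    funext t
    by_cases ht : 0 ≤ t
    · rw [indicator_of_mem (mem_Ici.2 ht), expKernel, if_pos ht, mul_pow, ← Real.exp_nat_mul]
      norm_num
    · rw [indicator_of_notMem (by simpa using ht), expKernel, if_neg ht]
      norm_num
  rw [hfun]
  constructor
  · rw [integrable_indicator_iff measurableSet_Ici, integrableOn_Ici_iff_integrableOn_Ioi]
    exact (integrableOn_exp_mul_Ioi (by norm_num) 0).const_mul 4
  · rw [integral_indicator measurableSet_Ici, integral_Ici_eq_integral_Ioi,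
      integral_const_mul, integral_exp_mul_Ioi (by norm_num)]
    norm_num

/-- Antiderivative of `((1 / t - 1 / t ^ 2) / 2) ^ 2`. -/
lemma hasDerivAt_tail_sq {t : ℝ} (ht : t ≠ 0) :
    HasDerivAt (fun t : ℝ => (-t⁻¹ + (t⁻¹) ^ 2 - (t⁻¹) ^ 3 / 3) / 4)
      (((1 / t - 1 / t ^ 2) / 2) ^ 2) t := by
  have h1 := hasDerivAt_inv ht
  refine ((((h1.neg).add (h1.pow 2)).sub ((h1.pow 3).div_const 3)).div_const 4).congr_deriv ?_
  simp
  field_simp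
  ring

lemma tendsto_tail_sq {l : Filter ℝ} (hl : Tendsto (fun t : ℝ => t⁻¹) l (𝓝 0)) :
    Tendsto (fun t : ℝ => (-t⁻¹ + (t⁻¹) ^ 2 - (t⁻¹) ^ 3 / 3) / 4) l (𝓝 0) := by
  simpa using (((hl.neg).add (hl.pow 2)).sub ((hl.pow 3).div_const 3)).div_const 4

lemma invKernel_sq_Ioi : IntegrableOn (fun t => invKernel t ^ 2) (Ioi 1) ∧
    ∫ t in Ioi (1 : ℝ), invKernel t ^ 2 = 1 / 12 := by
  have heq : EqOn (fun t : ℝ => ((1 / t - 1 / t ^ 2) / 2) ^ 2) (fun t => invKernel t ^ 2)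
      (Ioi 1) := fun t ht => by
    simp only [invKernel_of_abs_gt (lt_of_lt_of_le (mem_Ioi.1 ht) (le_abs_self t))]
  have hd : ∀ t ∈ Ici (1 : ℝ), HasDerivAt _ _ t := fun t ht =>
    hasDerivAt_tail_sq (by have := mem_Ici.1 ht; positivity : t ≠ 0)
  have hlim := tendsto_tail_sq tendsto_inv_atTop_zero
  refine ⟨(integrableOn_Ioi_deriv_of_nonneg' hd (fun t _ => by positivity) hlim).congr_fun heq
    measurableSet_Ioi, ?_⟩
  rw [← setIntegral_congr_fun measurableSet_Ioi heq,
    integral_Ioi_of_hasDerivAt_of_nonneg' hd (fun t _ => by positivity) hlim]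
  norm_num

lemma invKernel_sq_Iio : IntegrableOn (fun t => invKernel t ^ 2) (Iio (-1)) ∧
    ∫ t in Iio (-1 : ℝ), invKernel t ^ 2 = 7 / 12 := by
  have heq : EqOn (fun t : ℝ => ((1 / t - 1 / t ^ 2) / 2) ^ 2) (fun t => invKernel t ^ 2)
      (Iio (-1)) := fun t ht => by
    have : 1 < |t| := by have := neg_le_abs t; have := mem_Iio.1 ht; linarith
    simp only [invKernel_of_abs_gt this]
  have hd : ∀ t ∈ Ici (1 : ℝ), HasDerivAt (fun t : ℝ => -((-(-t)⁻¹ + ((-t)⁻¹) ^ 2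
      - ((-t)⁻¹) ^ 3 / 3) / 4)) (((1 / -t - 1 / (-t) ^ 2) / 2) ^ 2) t := fun t ht => by
    have h0 : -t ≠ 0 := by have := mem_Ici.1 ht; simp; positivity
    exact ((hasDerivAt_tail_sq h0).comp t (hasDerivAt_neg t)).neg.congr_deriv (by ring)
  have hlim : Tendsto (fun t : ℝ => -((-(-t)⁻¹ + ((-t)⁻¹) ^ 2
      - ((-t)⁻¹) ^ 3 / 3) / 4)) atTop (𝓝 0) := by
    rw [← neg_zero]
    exact ((tendsto_tail_sq tendsto_inv_atBot_zero).comp tendsto_neg_atTop_atBot).neg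
  have hint := integrableOn_Ioi_deriv_of_nonneg' hd (fun t _ => by positivity) hlim
  have hval := integral_Ioi_of_hasDerivAt_of_nonneg' hd (fun t _ => by positivity) hlim
  rw [integral_comp_neg_Ioi (1 : ℝ) (fun t : ℝ => ((1 / t - 1 / t ^ 2) / 2) ^ 2),
    integral_Iic_eq_integral_Iio] at hval
  refine ⟨IntegrableOn.congr_fun ?_ heq measurableSet_Iio, ?_⟩
  · rw [← integrableOn_Iic_iff_integrableOn_Iio, ← integrableOn_Ici_iff_integrableOn_Ioi] at *
    have := (Measure.measurePreserving_neg (volume : Measure ℝ)).integrableOn_comp_preimage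
      (f := fun t : ℝ => ((1 / t - 1 / t ^ 2) / 2) ^ 2) (s := Iic (-1))
      (Homeomorph.neg ℝ).measurableEmbedding
    rw [← this]
    simpa [Function.comp_def] using hint
  · rw [← setIntegral_congr_fun measurableSet_Iio heq, hval]
    norm_num

lemma invKernel_sq_Icc : IntegrableOn (fun t => invKernel t ^ 2) (Icc (-1) 1) ∧
    ∫ t in Icc (-1 : ℝ) 1, invKernel t ^ 2 = 2 / 3 := by
  have heq : EqOn (fun t : ℝ => ((t + 1) / 2) ^ 2) (fun t => invKernel t ^ 2)
      (Icc (-1) 1) := fun t ht => by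
    simp only [invKernel_of_abs_le (abs_le.2 ht)]
  refine ⟨IntegrableOn.congr_fun (Continuous.integrableOn_Icc (by fun_prop)) heq
    measurableSet_Icc, ?_⟩
  rw [← setIntegral_congr_fun measurableSet_Icc heq, integral_Icc_eq_integral_Ioc,
    ← intervalIntegral.integral_of_le (by norm_num)]
  rw [intervalIntegral.integral_eq_sub_of_hasDerivAt (f := fun t => (t + 1) ^ 3 / 12)
    (fun t _ => ?_) (Continuous.intervalIntegrable (by fun_prop) _ _)]
  · norm_num
  · refine ((((hasDerivAt_id t).add_const 1).pow 3).div_const 12).congr_deriv ?_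
    simp
    ring

lemma invKernel_sq_hasIntegral :
    Integrable (fun t => invKernel t ^ 2) ∧ ∫ t, invKernel t ^ 2 = 4 / 3 := by
  obtain ⟨h1, e1⟩ := invKernel_sq_Iio
  obtain ⟨h2, e2⟩ := invKernel_sq_Icc
  obtain ⟨h3, e3⟩ := invKernel_sq_Ioi
  have hd1 : Disjoint (Iio (-1 : ℝ)) (Icc (-1) 1) :=
    disjoint_left.2 fun t ht ht' => by linarith [mem_Iio.1 ht, ht'.1]
  have hd2 : Disjoint (Iio (-1 : ℝ) ∪ Icc (-1) 1) (Ioi 1) :=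
    disjoint_left.2 fun t ht ht' => by
      rcases ht with ht | ht
      · linarith [mem_Iio.1 ht, mem_Ioi.1 ht']
      · linarith [ht.2, mem_Ioi.1 ht']
  have hu : Iio (-1 : ℝ) ∪ Icc (-1) 1 ∪ Ioi 1 = univ := by
    rw [Iio_union_Icc_eq_Iic (by norm_num), Iic_union_Ioi]
  constructor
  · rw [← integrableOn_univ, ← hu]
    exact (h1.union h2).union h3
  · rw [← setIntegral_univ, ← hu, setIntegral_union hd2 measurableSet_Ioi (h1.union h2) h3,
      setIntegral_union hd1 measurableSet_Icc h1 h2, e1, e2, e3]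
    norm_num

lemma integrable_expKernel_mul_invKernel (x y : ℝ) :
    Integrable (fun s => expKernel (x - s) * invKernel (s - y)) := by
  have h1 : MemLp (fun s => expKernel (x - s)) 2 :=
    (memLp_two_iff_integrable_sq
      (measurable_expKernel.comp (by fun_prop)).aestronglyMeasurable).2
      (expKernel_sq_hasIntegral.1.comp_sub_left x)
  have h2 : MemLp (fun s => invKernel (s - y)) 2 :=
    (memLp_two_iff_integrable_sq
      (measurable_invKernel.comp (by fun_prop)).aestronglyMeasurable).2
      (invKernel_sq_hasIntegral.1.comp_sub_right y)
  exact h1.integrable_mul h2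

lemma hasDerivAt_exp_div (z : ℝ) {s : ℝ} (hs : s ≠ 0) :
    HasDerivAt (fun s => Real.exp (s - z) * s⁻¹) (Real.exp (s - z) * (1 / s - 1 / s ^ 2)) s := by
  refine ((((hasDerivAt_id s).sub_const z).exp).mul (hasDerivAt_inv hs)).congr_deriv ?_
  simp
  field_simp
  ring

lemma integrableOn_exp_mul_invKernel (z : ℝ) :
    IntegrableOn (fun s => 2 * Real.exp (s - z) * invKernel s) (Iic z) := by
  refine ((integrable_expKernel_mul_invKernel z 0).integrableOn (s := Iic z)).congr_fun
    (fun s hs => ?_) measurableSet_Iic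
  have : 0 ≤ z - s := sub_nonneg.2 hs
  simp [expKernel, this]

lemma setIntegral_Iic_exp_mul_invKernel_of_le_neg_one {z w : ℝ} (hw : w ≤ -1) (hwz : w ≤ z) :
    ∫ s in Iic w, 2 * Real.exp (s - z) * invKernel s = Real.exp (w - z) * w⁻¹ := by
  have heq : EqOn (fun s : ℝ => 2 * Real.exp (s - z) * invKernel s)
      (fun s => Real.exp (s - z) * (1 / s - 1 / s ^ 2)) (Iio w) := fun t ht => by
    have : 1 < |t| := by have := neg_le_abs t; have := mem_Iio.1 ht; linarith
    simp only [invKernel_of_abs_gt this]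
    ring
  have hint : IntegrableOn (fun s : ℝ => Real.exp (s - z) * (1 / s - 1 / s ^ 2)) (Iic w) := by
    rw [integrableOn_Iic_iff_integrableOn_Iio]
    exact ((integrableOn_exp_mul_invKernel z).mono_set
      (Iio_subset_Iic_self.trans (Iic_subset_Iic.2 hwz))).congr_fun heq measurableSet_Iio
  have hlim : Tendsto (fun s : ℝ => Real.exp (s - z) * s⁻¹) atBot (𝓝 0) := by
    simpa [sub_eq_add_neg] using (Real.tendsto_exp_atBot.comp
      (tendsto_atBot_add_const_right _ (-z) tendsto_id)).mul tendsto_inv_atBot_zero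
  rw [integral_Iic_eq_integral_Iio, setIntegral_congr_fun measurableSet_Iio heq,
    ← integral_Iic_eq_integral_Iio,
    integral_Iic_of_hasDerivAt_of_tendsto' (fun s hs => hasDerivAt_exp_div z
      (by have := mem_Iic.1 hs; linarith : s < 0).ne) hint hlim, sub_zero]

lemma setIntegral_Iic_exp_mul_invKernel {z : ℝ} (hz : 1 ≤ |z|) :
    ∫ s in Iic z, 2 * Real.exp (s - z) * invKernel s = 1 / z := by
  rcases le_abs'.1 hz with hz | hz
  · rw [setIntegral_Iic_exp_mul_invKernel_of_le_neg_one hz le_rfl]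
    simp
  have hi := integrableOn_exp_mul_invKernel z
  have i1 := hi.mono_set (Iic_subset_Iic.2 (by linarith : (-1 : ℝ) ≤ z))
  have i2 := hi.mono_set (Iic_subset_Iic.2 hz)
  have e1 := intervalIntegral.integral_Iic_sub_Iic i2 hi
  have e2 := intervalIntegral.integral_Iic_sub_Iic i1 i2
  rw [setIntegral_Iic_exp_mul_invKernel_of_le_neg_one le_rfl (by linarith)] at e2
  have v2 : ∫ s in (-1 : ℝ)..1, 2 * Real.exp (s - z) * invKernel s
      = Real.exp (1 - z) + Real.exp (-1 - z) := by
    rw [intervalIntegral.integral_congr (g := fun s => Real.exp (s - z) * (s + 1)),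
      intervalIntegral.integral_eq_sub_of_hasDerivAt (f := fun s => Real.exp (s - z) * s)
      (fun s _ => ?_) (Continuous.intervalIntegrable (by fun_prop) _ _)]
    · ring
    · refine ((((hasDerivAt_id s).sub_const z).exp).mul (hasDerivAt_id s)).congr_deriv ?_
      simp
      ring
    · intro s hs
      rw [uIcc_of_le (by norm_num)] at hs
      simp only [invKernel_of_abs_le (abs_le.2 hs)]
      ring
  have v1 : ∫ s in (1 : ℝ)..z, 2 * Real.exp (s - z) * invKernel s = 1 / z - Real.exp (1 - z) := by
    have hpos : ∀ s ∈ uIcc 1 z, s ≠ 0 := fun s hs => by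
      rw [uIcc_of_le hz] at hs
      exact (zero_lt_one.trans_le hs.1).ne'
    rw [intervalIntegral.integral_congr_Ioo_of_le
        (g := fun s => Real.exp (s - z) * (1 / s - 1 / s ^ 2)) hz fun s hs => ?_,
      intervalIntegral.integral_eq_sub_of_hasDerivAt
        (fun s hs => hasDerivAt_exp_div z (hpos s hs)) (ContinuousOn.intervalIntegrable ?_)]
    · simp
    · refine ContinuousOn.mul (by fun_prop) (ContinuousOn.sub ?_ ?_)
      · exact ContinuousOn.div (by fun_prop) (by fun_prop) hpos
      · exact ContinuousOn.div (by fun_prop) (by fun_prop) fun s hs => pow_ne_zero 2 (hpos s hs)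
    · simp only [invKernel_of_abs_gt (lt_of_lt_of_le hs.1 (le_abs_self s))]
      ring
  rw [v2] at e2
  rw [v1] at e1
  norm_num at e2 e1 ⊢
  linarith

lemma integral_expKernel_mul_invKernel {x y : ℝ} (hxy : 1 ≤ |x - y|) :
    ∫ s, expKernel (x - s) * invKernel (s - y) = 1 / (x - y) := by
  rw [← setIntegral_Iic_exp_mul_invKernel hxy, ← integral_indicator measurableSet_Iic,
    ← integral_add_right_eq_self _ y]
  congr 1
  funext s
  rw [add_sub_cancel_right]
  by_cases hs : s ≤ x - y
  · rw [indicator_of_mem (mem_Iic.2 hs), expKernel, if_pos (by linarith)]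
    congr 3
    ring
  · rw [indicator_of_notMem (by simpa using hs), expKernel, if_neg (by linarith), zero_mul]

end Kernel

section Filters

variable {ι E : Type*} [Fintype ι] [NormedAddCommGroup E] [InnerProductSpace ℝ E]

lemma OrthonormalBasis.norm_sum_smul_sq (b : OrthonormalBasis ι ℝ E) (s : Finset ι) (a : ι → ℝ) :
    ‖∑ i ∈ s, a i • b i‖ ^ 2 = ∑ i ∈ s, a i ^ 2 := by
  rw [← real_inner_self_eq_norm_sq, b.orthonormal.inner_sum]
  simp [sq]

lemma OrthonormalBasis.sum_inner_sq (b : OrthonormalBasis ι ℝ E) (f : E) :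
    ∑ i, ⟪f, b i⟫ ^ 2 = ‖f‖ ^ 2 := by
  simpa using b.sum_sq_norm_inner_left f

lemma OrthonormalBasis.norm_sum_mul_inner_smul_le (b : OrthonormalBasis ι ℝ E) {w : ι → ℝ} {c : ℝ}
    (hc : 0 ≤ c) (hw : ∀ i, |w i| ≤ c) (f : E) :
    ‖∑ i, (w i * ⟪f, b i⟫) • b i‖ ≤ c * ‖f‖ := by
  refine le_of_sq_le_sq ?_ (by positivity)
  rw [b.norm_sum_smul_sq, mul_pow, ← b.sum_inner_sq, Finset.mul_sum]
  gcongr with i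
  rw [mul_pow, ← sq_abs (w i)]
  gcongr
  exact hw i

section Weyl

lemma OrthonormalBasis.inner_map_self_eq_sum (b : OrthonormalBasis ι ℝ E) (T : E →L[ℝ] E)
    {μ : ι → ℝ} (hb : ∀ i, T (b i) = μ i • b i) (x : E) :
    ⟪T x, x⟫ = ∑ i, μ i * ⟪b i, x⟫ ^ 2 := by
  conv_lhs => rw [← b.sum_repr' x, map_sum, sum_inner, b.sum_repr' x]
  refine Finset.sum_congr rfl fun i _ => ?_
  rw [map_smul, hb, inner_smul_left, inner_smul_left]
  simp
  ring

/-- One-sided Weyl inequality for eigenvalues listed in nondecreasing order. -/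
lemma eigenvalue_le_add_of_inner_le {n : ℕ} {T T' : E →L[ℝ] E} {ε : ℝ}
    (hTT' : ∀ x, ⟪T' x, x⟫ ≤ ⟪T x, x⟫ + ε * ‖x‖ ^ 2)
    {μ μ' : Fin n → ℝ} (hμ : Monotone μ) (hμ' : Monotone μ')
    (b b' : OrthonormalBasis (Fin n) ℝ E)
    (hb : ∀ i, T (b i) = μ i • b i) (hb' : ∀ i, T' (b' i) = μ' i • b' i) (i : Fin n) :
    μ' i ≤ μ i + ε := by
  have := b.toBasis.finiteDimensional_of_finite
  let φ : E →ₗ[ℝ] (Fin n → ℝ) := LinearMap.pi fun j =>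
    if i < j then (innerₛₗ ℝ (b j)) else if j < i then (innerₛₗ ℝ (b' j)) else 0
  have hφ : ∀ x j, φ x j = if i < j then ⟪b j, x⟫ else if j < i then ⟪b' j, x⟫ else 0 := by
    intro x j
    simp only [φ, LinearMap.pi_apply]
    split_ifs <;> simp
  have hninj : ¬ Function.Injective φ := by
    rw [LinearMap.injective_iff_surjective_of_finrank_eq_finrank
      (by simp [Module.finrank_eq_card_basis b.toBasis])]
    intro hs
    obtain ⟨x, hx⟩ := hs (Pi.single i 1)
    have := congrFun hx i
    simp [hφ] at this
  rw [injective_iff_map_eq_zero] at hninj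
  push Not at hninj
  obtain ⟨x, hx, hx0⟩ := hninj
  have hgt : ∀ j, i < j → ⟪b j, x⟫ = 0 := fun j hj => by
    have := congrFun hx j
    simpa [hφ, hj] using this
  have hlt : ∀ j, j < i → ⟪b' j, x⟫ = 0 := fun j hj => by
    have := congrFun hx j
    simpa [hφ, hj, hj.not_gt] using this
  have h1 : ⟪T x, x⟫ ≤ μ i * ‖x‖ ^ 2 := by
    rw [b.inner_map_self_eq_sum T hb, ← b.sum_inner_sq, Finset.mul_sum]
    refine Finset.sum_le_sum fun j _ => ?_
    rw [real_inner_comm (b j) x]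
    rcases le_or_gt j i with hj | hj
    · exact mul_le_mul_of_nonneg_right (hμ hj) (sq_nonneg _)
    · simp [hgt j hj]
  have h2 : μ' i * ‖x‖ ^ 2 ≤ ⟪T' x, x⟫ := by
    rw [b'.inner_map_self_eq_sum T' hb', ← b'.sum_inner_sq, Finset.mul_sum]
    refine Finset.sum_le_sum fun j _ => ?_
    rw [real_inner_comm (b' j) x]
    rcases le_or_gt i j with hj | hj
    · exact mul_le_mul_of_nonneg_right (hμ' hj) (sq_nonneg _)
    · simp [hlt j hj]
  have hpos : 0 < ‖x‖ ^ 2 := by positivity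
  refine le_of_mul_le_mul_right ?_ hpos
  linarith [hTT' x]

end Weyl

section Sylvester
open MeasureTheory

variable (b b' : OrthonormalBasis ι ℝ E)

lemma integral_sum_mul_sq_le {ι : Type*} {c : ℝ} (s : Finset ι) (u x : ι → ℝ)
    (K : ℝ → ℝ → ℝ) (hK : ∀ x, Integrable (fun t => K x t ^ 2))
    (hKc : ∀ x, ∫ t, K x t ^ 2 ≤ c) :
    Integrable (fun t => ∑ i ∈ s, (K (x i) t * u i) ^ 2) ∧
    ∫ t, ∑ i ∈ s, (K (x i) t * u i) ^ 2 ≤ c * ∑ i ∈ s, u i ^ 2 := by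
  have hi : ∀ i ∈ s, Integrable (fun t => (K (x i) t * u i) ^ 2) := fun i _ => by
    simpa only [mul_pow] using (hK (x i)).mul_const _
  refine ⟨integrable_finsetSum _ hi, ?_⟩
  rw [integral_finsetSum _ hi, Finset.mul_sum]
  gcongr with i
  simp only [mul_pow]
  rw [integral_mul_const]
  gcongr
  exact hKc _

/-- If `x i` and `y j` are at distance at least `1`, the Schur multiplier `1 / (x i - y j)` is
bounded on the matrix of an operator. -/
lemma abs_sum_div_sub_le (A : E →L[ℝ] E) (I J : Finset ι) (x y u v : ι → ℝ)
    (hsep : ∀ i ∈ I, ∀ j ∈ J, 1 ≤ |x i - y j|) :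
    |∑ i ∈ I, ∑ j ∈ J, u i * v j * (⟪b i, A (b' j)⟫ / (x i - y j))|
      ≤ ‖A‖ * (∑ i ∈ I, u i ^ 2 + ∑ j ∈ J, v j ^ 2) := by
  set U : ℝ → E := fun s => ∑ i ∈ I, (expKernel (x i - s) * u i) • b i with hU
  set V : ℝ → E := fun s => ∑ j ∈ J, (invKernel (s - y j) * v j) • b' j with hV
  have hsum : ∑ i ∈ I, ∑ j ∈ J, u i * v j * (⟪b i, A (b' j)⟫ / (x i - y j))
      = ∫ s, ⟪U s, A (V s)⟫ := by
    have hUV : ∀ s, ⟪U s, A (V s)⟫ = ∑ i ∈ I, ∑ j ∈ J,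
        (u i * v j * ⟪b i, A (b' j)⟫) * (expKernel (x i - s) * invKernel (s - y j)) := by
      intro s
      simp only [hU, hV, map_sum, map_smul, sum_inner, inner_sum, inner_smul_left,
        inner_smul_right]
      rw [Finset.sum_comm]
      refine Finset.sum_congr rfl fun j _ => ?_
      rw [Finset.mul_sum]
      refine Finset.sum_congr rfl fun i _ => ?_
      simp
      ring
    have hint : ∀ i j, Integrable (fun s => (u i * v j * ⟪b i, A (b' j)⟫) *
        (expKernel (x i - s) * invKernel (s - y j))) := fun i j =>
      (integrable_expKernel_mul_invKernel _ _).const_mul _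
    simp_rw [hUV]
    rw [integral_finsetSum _ fun i _ => integrable_finsetSum _ fun j _ => hint i j]
    refine Finset.sum_congr rfl fun i hi => ?_
    rw [integral_finsetSum _ fun j _ => hint i j]
    refine Finset.sum_congr rfl fun j hj => ?_
    rw [integral_const_mul, integral_expKernel_mul_invKernel (hsep i hi j hj)]
    ring
  obtain ⟨iU, eU⟩ := integral_sum_mul_sq_le (c := 2) I u x (fun x s => expKernel (x - s))
    (fun x => expKernel_sq_hasIntegral.1.comp_sub_left x)
    (fun x => by
      rw [integral_sub_left_eq_self (fun t => expKernel t ^ 2), expKernel_sq_hasIntegral.2])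
  obtain ⟨iV, eV⟩ := integral_sum_mul_sq_le (c := 2) J v y (fun y s => invKernel (s - y))
    (fun y => invKernel_sq_hasIntegral.1.comp_sub_right y)
    (fun y => by
      rw [integral_sub_right_eq_self (fun t => invKernel t ^ 2), invKernel_sq_hasIntegral.2]
      norm_num)
  rw [hsum, ← Real.norm_eq_abs]
  calc ‖∫ s, ⟪U s, A (V s)⟫‖
      ≤ ∫ s, ‖A‖ / 2 * (∑ i ∈ I, (expKernel (x i - s) * u i) ^ 2
          + ∑ j ∈ J, (invKernel (s - y j) * v j) ^ 2) := by
        refine norm_integral_le_of_norm_le ((iU.add iV).const_mul _) (ae_of_all _ fun s => ?_)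
        rw [← b.norm_sum_smul_sq, ← b'.norm_sum_smul_sq]
        calc ‖⟪U s, A (V s)⟫‖ ≤ ‖U s‖ * (‖A‖ * ‖V s‖) :=
              (norm_inner_le_norm _ _).trans (by gcongr; exact A.le_opNorm _)
          _ = ‖A‖ * (‖U s‖ * ‖V s‖) := by ring
          _ ≤ ‖A‖ * ((‖U s‖ ^ 2 + ‖V s‖ ^ 2) / 2) := by
              gcongr
              linarith [two_mul_le_add_sq ‖U s‖ ‖V s‖]
          _ = _ := by ring
    _ ≤ _ := by
        rw [integral_const_mul, integral_add iU iV]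
        nlinarith [norm_nonneg A]

/-- If `b i`, `b' j` are eigenvectors with eigenvalues at distance at least `d`, the corresponding
block of the change of basis matrix is of size at most `2 * ‖A‖ / d`. -/
lemma abs_sum_mul_inner_le (A : E →L[ℝ] E) {μ μ' : ι → ℝ} {d : ℝ} (hd : 0 < d)
    (hA : ∀ i j, ⟪b i, A (b' j)⟫ = (μ' j - μ i) * ⟪b i, b' j⟫) (I J : Finset ι) (u v : ι → ℝ)
    (hsep : ∀ i ∈ I, ∀ j ∈ J, d ≤ |μ i - μ' j|) :
    |∑ i ∈ I, ∑ j ∈ J, u i * v j * ⟪b i, b' j⟫|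
      ≤ ‖A‖ / d * (∑ i ∈ I, u i ^ 2 + ∑ j ∈ J, v j ^ 2) := by
  have key := abs_sum_div_sub_le b b' A I J (fun i => μ i / d) (fun j => μ' j / d) u v
    fun i hi j hj => by
      rw [← sub_div, abs_div, abs_of_pos hd, le_div_iff₀ hd, one_mul]
      exact hsep i hi j hj
  have heq : ∑ i ∈ I, ∑ j ∈ J, u i * v j * (⟪b i, A (b' j)⟫ / (μ i / d - μ' j / d))
      = -d * ∑ i ∈ I, ∑ j ∈ J, u i * v j * ⟪b i, b' j⟫ := by
    rw [Finset.mul_sum]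
    refine Finset.sum_congr rfl fun i hi => ?_
    rw [Finset.mul_sum]
    refine Finset.sum_congr rfl fun j hj => ?_
    have h0 : μ i - μ' j ≠ 0 := abs_pos.1 (hd.trans_le (hsep i hi j hj))
    rw [hA, ← sub_div]
    field_simp
    ring
  rw [heq, abs_mul, abs_neg, abs_of_pos hd, mul_comm, ← le_div_iff₀ hd] at key
  exact key.trans_eq (by ring)

lemma norm_le_of_inner_le_add_sq {f x : E} {m : ℝ} (hm : 0 ≤ m)
    (h : ∀ (s t : ℝ), ⟪s • x, t • x⟫ ≤ m * (s ^ 2 * ‖f‖ ^ 2 + ‖t • x‖ ^ 2)) :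
    ‖x‖ ≤ 2 * m * ‖f‖ := by
  rcases (norm_nonneg x).eq_or_lt with hx | hx
  · rw [← hx]
    positivity
  rcases (norm_nonneg f).eq_or_lt with hf | hf
  · have h0 := h (2 * m + 1) 1
    have hs := real_inner_self_eq_norm_sq x
    rw [← hf, inner_smul_left, inner_smul_right, hs, norm_smul] at h0
    norm_num at h0
    nlinarith [mul_pos hx hx]
  · have h0 := h ‖x‖ ‖f‖
    rw [inner_smul_left, inner_smul_right, real_inner_self_eq_norm_sq, norm_smul,
      norm_norm] at h0
    simp only [conj_trivial] at h0
    have hp : 0 < ‖f‖ * ‖x‖ ^ 2 := by positivity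
    refine le_of_mul_le_mul_right ?_ hp
    nlinarith

/-- Distance between the spectral projections of two operators whose spectra are separated by `d`
off the matching index sets. -/
lemma norm_sum_inner_smul_sub_le [DecidableEq ι] (A : E →L[ℝ] E) {μ μ' : ι → ℝ} {d : ℝ}
    (hd : 0 < d) (hA : ∀ i j, ⟪b i, A (b' j)⟫ = (μ' j - μ i) * ⟪b i, b' j⟫) (S : Finset ι)
    (hsep : ∀ i j, (i ∈ S ↔ j ∉ S) → d ≤ |μ i - μ' j|) (f : E) :
    ‖∑ i ∈ S, ⟪f, b i⟫ • b i - ∑ i ∈ S, ⟪f, b' i⟫ • b' i‖ ≤ 2 * (‖A‖ / d) * ‖f‖ := by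
  have key : ∀ f w : E, ⟪∑ i ∈ S, ⟪f, b i⟫ • b i - ∑ i ∈ S, ⟪f, b' i⟫ • b' i, w⟫
      ≤ ‖A‖ / d * (‖f‖ ^ 2 + ‖w‖ ^ 2) := by
    intro f w
    let F : ι → ι → ℝ := fun i j => ⟪w, b i⟫ * ⟪f, b' j⟫ * ⟪b i, b' j⟫
    have e1 : ⟪∑ i ∈ S, ⟪f, b i⟫ • b i, w⟫ = ∑ i ∈ S, ∑ j, F i j := by
      rw [sum_inner]
      refine Finset.sum_congr rfl fun i _ => ?_
      rw [inner_smul_left, ← b'.sum_inner_mul_inner f (b i), real_inner_comm w]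
      simp only [conj_trivial]
      rw [Finset.sum_mul]
      refine Finset.sum_congr rfl fun j _ => ?_
      simp only [F]
      rw [real_inner_comm (b i) (b' j)]
      ring
    have e2 : ⟪∑ i ∈ S, ⟪f, b' i⟫ • b' i, w⟫ = ∑ j ∈ S, ∑ i, F i j := by
      rw [sum_inner]
      refine Finset.sum_congr rfl fun j _ => ?_
      rw [inner_smul_left, real_inner_comm w, ← b.sum_inner_mul_inner w (b' j)]
      simp only [conj_trivial]
      rw [Finset.mul_sum]
      refine Finset.sum_congr rfl fun i _ => ?_
      simp only [F]
      ring
    have h1 := abs_le.1 (abs_sum_mul_inner_le b b' A hd hA S Sᶜ (fun i => ⟪w, b i⟫)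
      (fun j => ⟪f, b' j⟫) fun i hi j hj => hsep i j (by simp_all))
    have h2 := abs_le.1 (abs_sum_mul_inner_le b b' A hd hA Sᶜ S (fun i => ⟪w, b i⟫)
      (fun j => ⟪f, b' j⟫) fun i hi j hj => hsep i j (by simp_all))
    have e3 : ∑ i ∈ S, ∑ j, F i j = ∑ i ∈ S, ∑ j ∈ S, F i j + ∑ i ∈ S, ∑ j ∈ Sᶜ, F i j := by
      simp only [← Finset.sum_add_distrib, Finset.sum_add_sum_compl]
    have e4 : ∑ j ∈ S, ∑ i, F i j = ∑ i ∈ S, ∑ j ∈ S, F i j + ∑ i ∈ Sᶜ, ∑ j ∈ S, F i j := by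
      rw [Finset.sum_add_sum_compl, Finset.sum_comm]
    rw [inner_sub_left, e1, e2, e3, e4, ← b'.sum_inner_sq f, ← b.sum_inner_sq w,
      ← Finset.sum_add_sum_compl S, ← Finset.sum_add_sum_compl S (fun i => ⟪w, b i⟫ ^ 2)]
    simp only [F]
    linarith [h1.2, h2.1]
  refine norm_le_of_inner_le_add_sq (by positivity) fun s t => ?_
  convert key (s • f) (t • _) using 2
  · simp only [inner_smul_left, smul_sub, Finset.smul_sum, smul_smul, conj_trivial]
  · rw [norm_smul s f, mul_pow, Real.norm_eq_abs, sq_abs]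

end Sylvester

/-- Values which pairwise differ by at most `δ` lie within `δ / 2` of a common centre. -/
lemma exists_abs_sub_le_half {S : Finset ℝ} {δ C : ℝ} (hC : 0 ≤ C) (hS : ∀ x ∈ S, |x| ≤ C)
    (hδ : ∀ x ∈ S, ∀ y ∈ S, |x - y| ≤ δ) : ∃ c, |c| ≤ C ∧ ∀ x ∈ S, |x - c| ≤ δ / 2 := by
  rcases S.eq_empty_or_nonempty with rfl | hne
  · exact ⟨0, by simpa using hC, by simp⟩
  refine ⟨(S.max' hne + S.min' hne) / 2, ?_, fun x hx => ?_⟩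
  · have h1 := abs_le.1 (hS _ (S.max'_mem hne))
    have h2 := abs_le.1 (hS _ (S.min'_mem hne))
    exact abs_le.2 ⟨by linarith, by linarith⟩
  · have h1 := S.le_max' x hx
    have h2 := S.min'_le x hx
    have h3 := (abs_le.1 (hδ _ (S.max'_mem hne) _ (S.min'_mem hne))).2
    exact abs_le.2 ⟨by linarith, by linarith⟩

/-- Comparison of two filters constant on the parts of a partition of the index set. -/
lemma norm_sum_const_on_parts_sub_le {κ : Type*} [Fintype κ] [DecidableEq κ]
    (b b' : OrthonormalBasis ι ℝ E) (p : ι → κ) {c : κ → ℝ} {m : ℝ} (hc : ∀ k, |c k| ≤ 1) (f : E)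
    (hm : ∀ k, ‖∑ i with p i = k, ⟪f, b i⟫ • b i - ∑ i with p i = k, ⟪f, b' i⟫ • b' i‖ ≤ m) :
    ‖(∑ i, (c (p i) * ⟪f, b i⟫) • b i) - ∑ i, (c (p i) * ⟪f, b' i⟫) • b' i‖
      ≤ Fintype.card κ * m := by
  have hsum : ∀ b : OrthonormalBasis ι ℝ E, ∑ i, (c (p i) * ⟪f, b i⟫) • b i
      = ∑ k, c k • ∑ i with p i = k, ⟪f, b i⟫ • b i := fun b => by
    rw [← Finset.sum_fiberwise Finset.univ p]
    refine Finset.sum_congr rfl fun k _ => ?_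
    rw [Finset.smul_sum]
    refine Finset.sum_congr rfl fun i hi => ?_
    rw [(Finset.mem_filter.1 hi).2, mul_smul]
  rw [hsum b, hsum b', ← Finset.sum_sub_distrib]
  refine (norm_sum_le _ _).trans ?_
  rw [← nsmul_eq_mul, ← Finset.card_univ]
  refine Finset.sum_le_card_nsmul _ _ _ fun k _ => ?_
  rw [← smul_sub, norm_smul]
  exact (mul_le_of_le_one_left (norm_nonneg _) (hc k)).trans (hm k)

end Filters

/-- Single-filter stability bound (key step of Theorem 1): if the spectrum of the
self-adjoint operator `L` admits an `α`-separated partition `Λ 1 ∪ ... ∪ Λ N`, `A` is a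
self-adjoint perturbation with `‖A‖ = ε`, `0 < ε < α`, and `h` is a `B`-Lipschitz,
non-amplifying `α`-FDT filter with threshold `π ε / (2(α - ε))` (where the eigenvalue
`μ' i` of `L' = L + A` is associated with the part `Λ (κ i)` containing `μ i`), then
`‖h(L) f - h(L') f‖ ≤ (N π / (α - ε) + B) ε ‖f‖`. -/
theorem fdt_filter_stability
    {E : Type*} [NormedAddCommGroup E] [InnerProductSpace ℝ E] [FiniteDimensional ℝ E]
    {n N : ℕ} (L A : E →L[ℝ] E)
    (hL : ∀ x y : E, ⟪L x, y⟫ = ⟪x, L y⟫)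
    (hA : ∀ x y : E, ⟪A x, y⟫ = ⟪x, A y⟫)
    (α ε : ℝ) (hε0 : 0 < ε) (hεα : ε < α) (hAnorm : ‖A‖ = ε)
    (μ μ' : Fin n → ℝ) (hμ : Monotone μ) (hμ' : Monotone μ')
    (b b' : OrthonormalBasis (Fin n) ℝ E)
    (hb : ∀ i, L (b i) = μ i • b i)
    (hb' : ∀ i, (L + A) (b' i) = μ' i • b' i)
    (Λ : Fin N → Set ℝ) (κ : Fin n → Fin N)
    (hκ : ∀ i, μ i ∈ Λ (κ i))
    (hpart : ∀ k, Λ k ⊆ Set.range μ)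
    (hsep : ∀ k l : Fin N, k ≠ l → ∀ x ∈ Λ k, ∀ y ∈ Λ l, α < |x - y|)
    (h : ℝ → ℝ) (B : ℝ)
    (hLip : ∀ a c : ℝ, |h a - h c| ≤ B * |a - c|)
    (hbd : ∀ x : ℝ, |h x| ≤ 1)
    (hFDT : ∀ i j : Fin n, κ i = κ j →
      |h (μ i) - h (μ j)| ≤ Real.pi * ε / (2 * (α - ε)) ∧
      |h (μ i) - h (μ' j)| ≤ Real.pi * ε / (2 * (α - ε)) ∧
      |h (μ' i) - h (μ' j)| ≤ Real.pi * ε / (2 * (α - ε)))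
    (f : E) :
    ‖(∑ i, (h (μ i) * ⟪f, b i⟫) • b i) - ∑ i, (h (μ' i) * ⟪f, b' i⟫) • b' i‖
      ≤ ((N : ℝ) * Real.pi / (α - ε) + B) * ε * ‖f‖ := by
  have hαε : 0 < α - ε := sub_pos.2 hεα
  set δ : ℝ := Real.pi * ε / (2 * (α - ε)) with hδ
  have hδ0 : 0 ≤ δ := by positivity
  have hA_le : ∀ x : E, |⟪A x, x⟫| ≤ ε * ‖x‖ ^ 2 := fun x => by
    calc |⟪A x, x⟫| ≤ ‖A x‖ * ‖x‖ := abs_real_inner_le_norm _ _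
      _ ≤ ‖A‖ * ‖x‖ * ‖x‖ := by gcongr; exact A.le_opNorm x
      _ = ε * ‖x‖ ^ 2 := by rw [hAnorm]; ring
  have hweyl : ∀ i, |μ i - μ' i| ≤ ε := fun i => by
    have h1 : μ' i ≤ μ i + ε := eigenvalue_le_add_of_inner_le (fun x => by
      rw [_root_.add_apply, inner_add_left]
      linarith [(abs_le.1 (hA_le x)).2]) hμ hμ' b b' hb hb' i
    have h2 : μ i ≤ μ' i + ε := eigenvalue_le_add_of_inner_le (fun x => by
      rw [_root_.add_apply, inner_add_left]
      linarith [(abs_le.1 (hA_le x)).1]) hμ' hμ b' b hb' hb i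
    exact abs_le.2 ⟨by linarith, by linarith⟩
  have hgap : ∀ i j, κ i ≠ κ j → α - ε ≤ |μ i - μ' j| := fun i j hij => by
    have h1 := hsep _ _ hij _ (hκ i) _ (hκ j)
    have h2 := hweyl j
    have h3 := abs_sub_le (μ i) (μ' j) (μ j)
    rw [abs_sub_comm (μ' j)] at h3
    linarith
  have hmat : ∀ i j, ⟪b i, A (b' j)⟫ = (μ' j - μ i) * ⟪b i, b' j⟫ := fun i j => by
    have h1 : A (b' j) = μ' j • b' j - L (b' j) := by
      rw [← hb' j, _root_.add_apply, add_sub_cancel_left]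
    rw [h1, inner_sub_right, ← hL, hb, inner_smul_left, inner_smul_right, conj_trivial]
    ring
  have hcentre : ∀ k, ∃ c, |c| ≤ 1 ∧ ∀ i, κ i = k →
      |h (μ i) - c| ≤ δ / 2 ∧ |h (μ' i) - c| ≤ δ / 2 := fun k => by
    obtain ⟨c, hc1, hc⟩ := exists_abs_sub_le_half (C := 1) (δ := δ)
      (S := (Finset.univ.filter (κ · = k)).image (h ∘ μ)
        ∪ (Finset.univ.filter (κ · = k)).image (h ∘ μ')) zero_le_one
      (fun x hx => by
        simp only [Finset.mem_union, Finset.mem_image, Function.comp_apply] at hx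
        obtain ⟨i, _, rfl⟩ | ⟨i, _, rfl⟩ := hx <;> exact hbd _)
      (fun x hx y hy => by
        simp only [Finset.mem_union, Finset.mem_image, Finset.mem_filter, Finset.mem_univ,
          true_and, Function.comp_apply] at hx hy
        obtain ⟨i, hi, rfl⟩ | ⟨i, hi, rfl⟩ := hx <;> obtain ⟨j, hj, rfl⟩ | ⟨j, hj, rfl⟩ := hy
        · exact (hFDT i j (hi.trans hj.symm)).1
        · exact (hFDT i j (hi.trans hj.symm)).2.1
        · rw [abs_sub_comm]
          exact (hFDT j i (hj.trans hi.symm)).2.1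
        · exact (hFDT i j (hi.trans hj.symm)).2.2)
    refine ⟨c, hc1, fun i hi => ⟨hc _ ?_, hc _ ?_⟩⟩
    · exact Finset.mem_union_left _ (Finset.mem_image_of_mem (h ∘ μ) (by simpa using hi))
    · exact Finset.mem_union_right _ (Finset.mem_image_of_mem (h ∘ μ') (by simpa using hi))
  choose c hc1 hc using hcentre
  have hdev : ‖∑ i, ((h (μ i) - c (κ i)) * ⟪f, b i⟫) • b i‖ ≤ δ / 2 * ‖f‖ :=
    b.norm_sum_mul_inner_smul_le (by positivity) (fun i => (hc _ i rfl).1) f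
  have hdev' : ‖∑ i, ((h (μ' i) - c (κ i)) * ⟪f, b' i⟫) • b' i‖ ≤ δ / 2 * ‖f‖ :=
    b'.norm_sum_mul_inner_smul_le (by positivity) (fun i => (hc _ i rfl).2) f
  set D : E := (∑ i, (c (κ i) * ⟪f, b i⟫) • b i) - ∑ i, (c (κ i) * ⟪f, b' i⟫) • b' i with hD
  have hsplit : ‖(∑ i, (h (μ i) * ⟪f, b i⟫) • b i) - ∑ i, (h (μ' i) * ⟪f, b' i⟫) • b' i‖
      ≤ δ * ‖f‖ + ‖D‖ := by
    have heq : (∑ i, (h (μ i) * ⟪f, b i⟫) • b i) - ∑ i, (h (μ' i) * ⟪f, b' i⟫) • b' i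
        = ∑ i, ((h (μ i) - c (κ i)) * ⟪f, b i⟫) • b i
          - ∑ i, ((h (μ' i) - c (κ i)) * ⟪f, b' i⟫) • b' i + D := by
      simp only [hD, sub_mul, sub_smul, Finset.sum_sub_distrib]
      abel
    rw [heq]
    linarith [norm_add_le (∑ i, ((h (μ i) - c (κ i)) * ⟪f, b i⟫) • b i
          - ∑ i, ((h (μ' i) - c (κ i)) * ⟪f, b' i⟫) • b' i) D,
      norm_sub_le (∑ i, ((h (μ i) - c (κ i)) * ⟪f, b i⟫) • b i)
        (∑ i, ((h (μ' i) - c (κ i)) * ⟪f, b' i⟫) • b' i)]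
  have hB : 0 ≤ B := by simpa using (abs_nonneg _).trans (hLip 1 0)
  have hBf : 0 ≤ B * ε * ‖f‖ := by positivity
  have hδN : ((N : ℝ) * Real.pi / (α - ε) + B) * ε * ‖f‖ = 2 * N * (δ * ‖f‖) + B * ε * ‖f‖ := by
    rw [hδ]
    field_simp
  rw [hδN]
  rcases isEmpty_or_nonempty (Fin n) with hn | ⟨⟨i₀⟩⟩
  · simp only [Finset.univ_eq_empty, Finset.sum_empty, sub_self, norm_zero]
    positivity
  have hN0 : 0 < N := (κ i₀).pos
  rcases (Nat.succ_le_of_lt hN0).eq_or_lt with hN1 | hN2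
  · subst hN1
    have hD0 : D = 0 := by
      rw [hD]
      simp only [Subsingleton.elim (κ _) 0, mul_smul, ← Finset.smul_sum]
      simp only [real_inner_comm _ f]
      rw [b.sum_repr', b'.sum_repr', sub_self]
    rw [hD0, norm_zero] at hsplit
    have : 0 ≤ δ * ‖f‖ := by positivity
    push_cast
    linarith
  · have hD1 : ‖D‖ ≤ N * (2 * (ε / (α - ε)) * ‖f‖) := by
      have := norm_sum_const_on_parts_sub_le b b' κ hc1 f
        (m := 2 * (‖A‖ / (α - ε)) * ‖f‖) fun k =>
          norm_sum_inner_smul_sub_le b b' A hαε hmat _ (fun i j hij => hgap i j fun h => by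
            simp [h] at hij) f
      rwa [Fintype.card_fin, hAnorm] at this
    have hN2' : (2 : ℝ) ≤ N := by exact_mod_cast hN2
    have hδ' : δ = Real.pi / 2 * (ε / (α - ε)) := by rw [hδ]; field_simp
    have hr : 0 ≤ ε / (α - ε) * ‖f‖ := by positivity
    have hpi := Real.pi_gt_three
    have hfin : Real.pi / 2 + 2 * N ≤ N * Real.pi := by nlinarith
    have := mul_le_mul_of_nonneg_right hfin hr
    rw [hδ'] at hsplit ⊢
    linarith
end

section
/- Let E be a normed real vector space, let D ≥ 1 and F_0, F_1, …, F_D be positive integers, let H_l^{pq} : E → E (for 1 ≤ l ≤ D, 1 ≤ p ≤ F_l, 1 ≤ q ≤ F_{l-1}) be bounded linear operators with operator norm ‖H_l^{pq}‖ ≤ 1, and let σ : E → E satisfy ‖σ(a) − σ(b)‖ ≤ ‖a − b‖ for all a, b ∈ E and σ(0) = 0. Given inputs f_0^1, …, f_0^{F_0} ∈ E, define recursively f_l^p = σ(Σ_{q=1}^{F_{l-1}} H_l^{pq} f_{l-1}^q). Then for every 1 ≤ l ≤ D and 1 ≤ p ≤ F_l, ‖f_l^p‖ ≤ (∏_{l'=1}^{l-1}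 F_{l'}) · Σ_{q=1}^{F_0} ‖f_0^q‖. -/
/-- A single layer with non-amplifying filters and a normalized Lipschitz nonlinearity is bounded
by the sum of the norms of its inputs. -/
theorem norm_layer_le_sum_norm {ι E : Type*} [NormedAddCommGroup E] [NormedSpace ℝ E]
    {σ : E → E} (hσ : ∀ a b : E, ‖σ a - σ b‖ ≤ ‖a - b‖) (hσ0 : σ 0 = 0)
    {s : Finset ι} {T : ι → E →L[ℝ] E} (hT : ∀ q ∈ s, ‖T q‖ ≤ 1) (x : ι → E) :
    ‖σ (∑ q ∈ s, T q (x q))‖ ≤ ∑ q ∈ s, ‖x q‖ :=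
  calc ‖σ (∑ q ∈ s, T q (x q))‖ ≤ ‖∑ q ∈ s, T q (x q)‖ := by
        simpa [hσ0] using hσ (∑ q ∈ s, T q (x q)) 0
    _ ≤ ∑ q ∈ s, ‖x q‖ := norm_sum_le_of_le s fun q hq => by
        simpa using (T q).le_of_opNorm_le (hT q hq) (x q)


/-- Intermediate feature-norm bound: in a layered network with non-amplifying filters
(`‖H l p q‖ ≤ 1`) and a normalized Lipschitz nonlinearity `σ`, the layer-`l` features
satisfy `‖feat l p‖ ≤ (∏_{l'=1}^{l-1} F_{l'}) ∑_{q < F₀} ‖feat 0 q‖`. -/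
theorem network_feature_norm_bound
    {E : Type*} [NormedAddCommGroup E] [NormedSpace ℝ E]
    (D : ℕ) (hD : 1 ≤ D) (Fd : ℕ → ℕ) (hFd : ∀ l ≤ D, 0 < Fd l)
    (H : ℕ → ℕ → ℕ → E →L[ℝ] E)
    (hH : ∀ l p q, 1 ≤ l → l ≤ D → p < Fd l → q < Fd (l - 1) → ‖H l p q‖ ≤ 1)
    (σ : E → E) (hσ : ∀ a b : E, ‖σ a - σ b‖ ≤ ‖a - b‖) (hσ0 : σ 0 = 0)
    (feat : ℕ → ℕ → E)
    (hrec : ∀ l, 1 ≤ l → l ≤ D → ∀ p < Fd l,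
      feat l p = σ (∑ q ∈ Finset.range (Fd (l - 1)), H l p q (feat (l - 1) q))) :
    ∀ l, 1 ≤ l → l ≤ D → ∀ p < Fd l,
      ‖feat l p‖ ≤ (∏ l' ∈ Finset.Icc 1 (l - 1), (Fd l' : ℝ)) *
        ∑ q ∈ Finset.range (Fd 0), ‖feat 0 q‖ := by
  have hstep : ∀ l, 1 ≤ l → l ≤ D → ∀ p < Fd l,
      ‖feat l p‖ ≤ ∑ q ∈ Finset.range (Fd (l - 1)), ‖feat (l - 1) q‖ := fun l hl hlD p hp => by
    rw [hrec l hl hlD p hp]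
    exact norm_layer_le_sum_norm hσ hσ0
      (fun q hq => hH l p q hl hlD hp (Finset.mem_range.mp hq)) _
  intro l hl
  induction l, hl using Nat.le_induction with
  | base => simpa using hstep 1 le_rfl
  | succ l hl ih =>
    intro hlD p hp
    have hsum := (hstep (l + 1) (by omega) hlD p hp).trans <|
      Finset.sum_le_card_nsmul _ _ _ fun q hq => ih (by omega) q (Finset.mem_range.mp hq)
    obtain ⟨k, rfl⟩ := Nat.exists_eq_add_of_le' hl
    simp only [Nat.add_sub_cancel, Finset.card_range, nsmul_eq_mul] at hsum ⊢
    rwa [Finset.prod_Icc_succ_top (by omega), mul_comm (∏ _ ∈ _, _), mul_assoc]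
end

section
/- Let E be a normed real vector space, let D ≥ 1 and F ≥ 1 be integers, and consider a D-layer network with F_0 = F_D = 1 and F_l = F for 1 ≤ l ≤ D−1 features per layer: given input f ∈ E, f_0^1 = f and f_l^p = σ(Σ_{q=1}^{F_{l-1}} H_l^{pq} f_{l-1}^q), and similarly f'_l^p with operators H'^{pq}_l in place of H_l^{pq}, where σ : E → E satisfies ‖σ(a) − σ(b)‖ ≤ ‖a − b‖ for all a, b ∈ E and σ(0) = 0, all operators satisfy ‖H_l^{pq}‖ ≤ 1 and ‖H'^{pq}_l‖ ≤ 1, and ‖H_l^{pq} g − H'^{pq}_l g‖ ≤ C‖g‖ for all g ∈ E and all l, p, q, for some C ≥ 0. Then ‖f_D^1 − f'^1_D‖ ≤ D · F^{D−1} · C · ‖f‖. -/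
/-- Number of features at layer `l` of a `D`-layer network with `F₀ = F_D = 1` and
`F_l = F` for `1 ≤ l ≤ D - 1`. -/
def featDim (D F l : ℕ) : ℕ := if l = 0 ∨ l = D then 1 else F

theorem norm_sum_apply_le {E : Type*} [NormedAddCommGroup E] [NormedSpace ℝ E]
    {ι : Type*} (s : Finset ι) {A : ι → E →L[ℝ] E} {x : ι → E} {M : ℝ}
    (hA : ∀ q ∈ s, ‖A q‖ ≤ 1) (hx : ∀ q ∈ s, ‖x q‖ ≤ M) :
    ‖∑ q ∈ s, A q (x q)‖ ≤ s.card * M := by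
  rw [← nsmul_eq_mul, ← Finset.sum_const]
  exact norm_sum_le_of_le s fun q hq ↦
    ((A q).le_of_opNorm_le (hA q hq) (x q)).trans (by simpa using hx q hq)

theorem norm_sum_apply_sub_sum_apply_le {E : Type*} [NormedAddCommGroup E] [NormedSpace ℝ E]
    {ι : Type*} (s : Finset ι) {A B : ι → E →L[ℝ] E} {x y : ι → E} {C M ε : ℝ} (hC : 0 ≤ C)
    (hB : ∀ q ∈ s, ‖B q‖ ≤ 1) (hAB : ∀ q ∈ s, ∀ g, ‖A q g - B q g‖ ≤ C * ‖g‖)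
    (hx : ∀ q ∈ s, ‖x q‖ ≤ M) (hxy : ∀ q ∈ s, ‖x q - y q‖ ≤ ε) :
    ‖∑ q ∈ s, A q (x q) - ∑ q ∈ s, B q (y q)‖ ≤ s.card * (C * M + ε) := by
  rw [← Finset.sum_sub_distrib, ← nsmul_eq_mul, ← Finset.sum_const]
  refine norm_sum_le_of_le s fun q hq ↦ ?_
  have hsplit : A q (x q) - B q (y q) = (A q (x q) - B q (x q)) + B q (x q - y q) := by
    rw [map_sub]; abel
  rw [hsplit]
  refine norm_add_le_of_le ?_ ?_
  · exact (hAB q hq (x q)).trans (mul_le_mul_of_nonneg_left (hx q hq) hC)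
  · exact ((B q).le_of_opNorm_le (hB q hq) _).trans (by simpa using hxy q hq)

/-- Abstract neural-network stability propagation: a uniform per-filter perturbation
bound `‖H_l^{pq} g - H'_l^{pq} g‖ ≤ C ‖g‖`, together with non-amplifying filters and a
normalized Lipschitz nonlinearity, yields the output bound
`‖Φ(f) - Φ'(f)‖ ≤ D F^{D-1} C ‖f‖` for a `D`-layer network with `F₀ = F_D = 1` and `F`
features in each hidden layer. -/
theorem network_perturbation_propagation
    {E : Type*} [NormedAddCommGroup E] [NormedSpace ℝ E]
    (D F : ℕ) (hD : 1 ≤ D) (hF : 1 ≤ F)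
    (H H' : ℕ → ℕ → ℕ → E →L[ℝ] E) (C : ℝ) (hC : 0 ≤ C)
    (hH : ∀ l p q, 1 ≤ l → l ≤ D → p < featDim D F l → q < featDim D F (l - 1) →
      ‖H l p q‖ ≤ 1)
    (hH' : ∀ l p q, 1 ≤ l → l ≤ D → p < featDim D F l → q < featDim D F (l - 1) →
      ‖H' l p q‖ ≤ 1)
    (hdiff : ∀ l p q, 1 ≤ l → l ≤ D → p < featDim D F l → q < featDim D F (l - 1) →
      ∀ g : E, ‖H l p q g - H' l p q g‖ ≤ C * ‖g‖)
    (σ : E → E) (hσ : ∀ a b : E, ‖σ a - σ b‖ ≤ ‖a - b‖) (hσ0 : σ 0 = 0)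
    (f : E) (feat feat' : ℕ → ℕ → E)
    (hfeat₀ : feat 0 0 = f) (hfeat₀' : feat' 0 0 = f)
    (hrec : ∀ l, 1 ≤ l → l ≤ D → ∀ p < featDim D F l,
      feat l p = σ (∑ q ∈ Finset.range (featDim D F (l - 1)), H l p q (feat (l - 1) q)))
    (hrec' : ∀ l, 1 ≤ l → l ≤ D → ∀ p < featDim D F l,
      feat' l p = σ (∑ q ∈ Finset.range (featDim D F (l - 1)), H' l p q (feat' (l - 1) q))) :
    ‖feat D 0 - feat' D 0‖ ≤ (D : ℝ) * (F : ℝ) ^ (D - 1) * C * ‖f‖ := by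
  have hσ_norm (a : E) : ‖σ a‖ ≤ ‖a‖ := by simpa [hσ0] using hσ a 0
  have layer_bound : ∀ l, l + 1 ≤ D → ∀ p < featDim D F (l + 1),
      ‖feat (l + 1) p‖ ≤ (F : ℝ) ^ l * ‖f‖ ∧
        ‖feat (l + 1) p - feat' (l + 1) p‖ ≤ ((l + 1 : ℕ) : ℝ) * (F : ℝ) ^ l * C * ‖f‖ := by
    have step : ∀ l, l + 1 ≤ D → ∀ M ε : ℝ,
        (∀ q < featDim D F l, ‖feat l q‖ ≤ M ∧ ‖feat l q - feat' l q‖ ≤ ε) →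
        ∀ p < featDim D F (l + 1), ‖feat (l + 1) p‖ ≤ featDim D F l * M ∧
          ‖feat (l + 1) p - feat' (l + 1) p‖ ≤ featDim D F l * (C * M + ε) := by
      intro l hl M ε h p hp
      have hl₁ : 1 ≤ l + 1 := by omega
      rw [hrec (l + 1) hl₁ hl p hp, hrec' (l + 1) hl₁ hl p hp]
      simp only [Nat.add_sub_cancel]
      constructor
      · refine (hσ_norm _).trans ?_
        simpa using norm_sum_apply_le (Finset.range (featDim D F l))
          (fun q hq ↦ hH (l + 1) p q hl₁ hl hp (Finset.mem_range.mp hq))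
          (fun q hq ↦ (h q (Finset.mem_range.mp hq)).1)
      · refine (hσ _ _).trans ?_
        simpa using norm_sum_apply_sub_sum_apply_le (Finset.range (featDim D F l)) hC
          (fun q hq ↦ hH' (l + 1) p q hl₁ hl hp (Finset.mem_range.mp hq))
          (fun q hq ↦ hdiff (l + 1) p q hl₁ hl hp (Finset.mem_range.mp hq))
          (fun q hq ↦ (h q (Finset.mem_range.mp hq)).1)
          (fun q hq ↦ (h q (Finset.mem_range.mp hq)).2)
    intro l
    induction l with
    | zero =>
      intro hl p hp
      have hdim : featDim D F 0 = 1 := by simp [featDim]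
      have h := step 0 hl ‖f‖ 0 (fun q hq ↦ by
        obtain rfl : q = 0 := by omega
        simp [hfeat₀, hfeat₀']) p hp
      simpa [hdim] using h
    | succ l ih =>
      intro hl p hp
      have hdim : featDim D F (l + 1) = F := by
        rw [featDim, if_neg (by omega)]
      have h := step (l + 1) hl _ _ (ih (by omega)) p hp
      rw [hdim] at h
      refine ⟨h.1.trans_eq (by ring), h.2.trans_eq (by push_cast; ring)⟩
  obtain ⟨l, rfl⟩ : ∃ l, D = l + 1 := ⟨D - 1, by omega⟩
  exact (layer_bound l le_rfl 0 (by simp [featDim])).2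
end
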